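/- The tetrahedral group T(3,3;2,2;3,3), presented as ⟨f1, f2, f3, f4 | f1^3 = f2^2 = f3^2 = f4^3 = 1, f1 f2 f3 f4 = 1, (f1 f2)^3 = 1, (f2 f4)^3 = 1⟩, admits a surjective homomorphism onto the alternating group A4 whose kernel has abelianization isomorphic to Z^3. -/

import Mathlib

open FreeGroup

/-- The relators of the tetrahedral group `T(n,m;2,2;c,3)`. -/
def tetRels (n m c : ℕ) : Set (FreeGroup (Fin 4)) :=
  {of 0 ^ c, of 1 ^ 2, of 2 ^ 2, of 3 ^ 3,
   of 0 * of 1 * of 2 * of 3, (of 0 * of 1) ^ n, (of 1 * of 3) ^ m}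

/-- The relations of the tetrahedral group `T(3,3;2,2;3,3)` after eliminating the third
generator. -/
structure TetTriple {G : Type*} [Group G] (a b d : G) : Prop where
  a_pow : a ^ 3 = 1
  b_pow : b ^ 2 = 1
  d_pow : d ^ 3 = 1
  ab_pow : (a * b) ^ 3 = 1
  bd_pow : (b * d) ^ 3 = 1
  dab_pow : (d * a * b) ^ 2 = 1

namespace TetTriple

section Relations

variable {G : Type*} [Group G] {a b d : G}

/-- The word representing a translation in a shortest lattice direction. -/
def transl (a b d : G) : G := b * (d * b * a) * b

theorem b_inv (h : TetTriple a b d) : b⁻¹ = b :=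
  inv_eq_of_mul_eq_one_left (by rw [← pow_two, h.b_pow])

theorem b_mul_b (h : TetTriple a b d) : b * b = 1 := by
  rw [← pow_two, h.b_pow]

theorem b_mul_b_mul (h : TetTriple a b d) (x : G) : b * (b * x) = x := by
  rw [← mul_assoc, h.b_mul_b, one_mul]

theorem a_mul_a (h : TetTriple a b d) : a * a = a⁻¹ :=
  eq_inv_of_mul_eq_one_left (by rw [← h.a_pow, pow_succ, pow_two])

theorem a_mul_a_mul (h : TetTriple a b d) (x : G) : a * (a * x) = a⁻¹ * x := by
  rw [← mul_assoc, h.a_mul_a]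

theorem a_inv_mul_a_inv (h : TetTriple a b d) : a⁻¹ * a⁻¹ = a := by
  rw [← mul_inv_rev, h.a_mul_a, inv_inv]

theorem bab (h : TetTriple a b d) : b * (a * b) = a⁻¹ * (b * a⁻¹) := by
  have := h.ab_pow
  have h2 : a * (b * (a * b)) * (a * b) = 1 := by
    rw [← this]; simp only [pow_succ, pow_zero, one_mul, mul_assoc]
  have h3 := eq_inv_of_mul_eq_one_left h2
  rw [mul_inv_rev, h.b_inv] at h3
  rw [← h3]; group

theorem bab_mul (h : TetTriple a b d) (x : G) :
    b * (a * (b * x)) = a⁻¹ * (b * (a⁻¹ * x)) := by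
  simpa [mul_assoc] using congrArg (· * x) h.bab

theorem a_conj_three (h : TetTriple a b d) (x : G) :
    a * (a * (a * x * a⁻¹) * a⁻¹) * a⁻¹ = x := by
  simp only [mul_assoc, h.a_mul_a_mul, h.a_inv_mul_a_inv]
  simp

theorem d_eq (h : TetTriple a b d) : d = b * transl a b d * b * (a⁻¹ * b) := by
  simp only [transl, mul_assoc, h.b_mul_b_mul]
  simp [h.b_mul_b]

theorem b_a_inv_b_mul (h : TetTriple a b d) (x : G) :
    b * (a⁻¹ * (b * x)) = a * (b * (a * x)) := by
  simpa [mul_assoc, h.b_inv] using congrArg (·⁻¹ * x) h.bab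

theorem dabd_mul (h : TetTriple a b d) (x : G) :
    d * (a * (b * (d * x))) = b * (a⁻¹ * x) := by
  have h1 : d * (a * (b * d)) * (a * b) = 1 := by
    rw [← h.dab_pow]; simp only [pow_two, mul_assoc]
  have h2 := eq_inv_of_mul_eq_one_left h1
  rw [mul_inv_rev, h.b_inv] at h2
  simpa [mul_assoc] using congrArg (· * x) h2

theorem b_conj_neg (h : TetTriple a b d) :
    b * (a⁻¹ * (d * b * a) * a) * b = (a⁻¹ * (d * b * a) * a)⁻¹ := by
  apply eq_inv_of_mul_eq_one_left
  simp only [mul_assoc, h.a_mul_a]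
  rw [← h.bab_mul, h.b_mul_b_mul, h.dabd_mul, h.b_a_inv_b_mul]
  simp [h.b_mul_b_mul]

theorem t_prod (h : TetTriple a b d) :
    (d * b * a) * (a⁻¹ * (d * b * a) * a) * (a * (d * b * a) * a⁻¹) = 1 := by
  simp only [mul_assoc, h.a_mul_a_mul, mul_inv_cancel_left, mul_inv_cancel, mul_one]
  have h1 : b * (d * (b * (d * (b * d)))) = 1 := by
    rw [← h.bd_pow]; simp only [pow_succ, pow_zero, one_mul, mul_assoc]
  have h2 := congrArg (fun x => b * x * b) h1
  simpa [mul_assoc, h.b_mul_b_mul, h.b_mul_b] using h2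

theorem t_prod' (h : TetTriple a b d) :
    (d * b * a) * (a⁻¹ * transl a b d * a) * (b * (a * (d * b * a) * a⁻¹) * b) = 1 := by
  simp only [transl, mul_assoc, h.b_mul_b, h.b_mul_b_mul, mul_inv_cancel_left,
    inv_mul_cancel_left, mul_one, h.bab_mul]
  rw [← h.d_pow]
  simp [pow_succ, mul_assoc]

theorem b_conj_second (h : TetTriple a b d) :
    b * (a * transl a b d * a⁻¹) * b = (a * (d * b * a) * a⁻¹)⁻¹ := by
  apply eq_inv_of_mul_eq_one_left
  simp only [transl, mul_assoc, mul_inv_cancel, mul_one]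
  rw [h.b_a_inv_b_mul, h.a_mul_a_mul, h.a_mul_a_mul, h.b_a_inv_b_mul, mul_inv_cancel_left,
    h.dabd_mul, h.b_mul_b_mul]
  simp [h.b_mul_b]

/-- The three shortest translations, cyclically permuted by `a`, and the effect of `b`. -/
theorem lattice (h : TetTriple a b d) (u v w : G) (hu : u = transl a b d)
    (hv : v = a * u * a⁻¹) (hw : w = a * v * a⁻¹) :
    a * w * a⁻¹ = u ∧ Commute u v ∧ Commute v w ∧ Commute w u ∧
      b * u * b = w⁻¹ * v ∧ b * v * b = w⁻¹ * u ∧ b * w * b = w⁻¹ := by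
  have hwu : a * w * a⁻¹ = u := by rw [hw, hv, h.a_conj_three]
  set A := MulAut.conj a with hA
  set B := MulAut.conj b with hB
  have eA (x : G) : A x = a * x * a⁻¹ := rfl
  have eA' (x : G) : A⁻¹ x = a⁻¹ * x * a := by simp [hA]
  have eB (x : G) : B x = b * x * b := by simp [hB, h.b_inv]
  obtain ⟨t, ht⟩ : ∃ t, t = d * b * a := ⟨_, rfl⟩
  have hBu : B u = t := by
    simp only [eB, hu, transl, mul_assoc, h.b_mul_b_mul, h.b_mul_b, mul_one, ht]
  have hBt : B t = u := by rw [eB, ht, hu, transl]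
  have h1 := h.t_prod
  have h2 := h.t_prod'
  have h3 := h.b_conj_neg
  have h4 := h.b_conj_second
  simp only [← ht, ← hu, ← hv, ← eA, ← eA', ← eB] at h1 h2 h3 h4 ⊢
  simp only [← eA] at hv hw hwu
  have hAw : A⁻¹ u = w := by rw [← hwu]; simp
  have hAv : A⁻¹ v = u := by rw [hv]; simp
  have hAw' : A⁻¹ w = v := by rw [hw]; simp
  have hBT : B (A t) = v⁻¹ := by
    have hBB : B (B v) = v := by
      simp only [eB, mul_assoc, h.b_mul_b_mul, h.b_mul_b, mul_one]
    rw [← hBB, h4, _root_.map_inv, inv_inv]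
  have htw : t = v * w⁻¹ := by
    rw [hBT, hAw] at h2
    rw [eq_mul_inv_iff_mul_eq, ← mul_inv_eq_one, h2]
  have hAt : A t = w * u⁻¹ := by rw [htw, _root_.map_mul, _root_.map_inv, ← hw, hwu]
  have hAt' : A⁻¹ t = u * v⁻¹ := by rw [htw, _root_.map_mul, _root_.map_inv, hAv, hAw']
  have hBw : B w = w⁻¹ := by
    have hw_eq : w = t⁻¹ * v := by rw [htw]; group
    rw [hw_eq, _root_.map_mul, _root_.map_inv, hBt, h4, hAt, htw]; group
  have huv : Commute u v := by
    have h5 := congrArg B h1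
    rw [_root_.map_mul, _root_.map_mul, _root_.map_one, hBt, h3, hBT, hAt'] at h5
    rw [mul_inv_eq_one, mul_inv_rev, inv_inv, ← mul_assoc, mul_inv_eq_iff_eq_mul] at h5
    exact h5
  have hvw : Commute v w := by simpa [← hv, ← hw] using huv.map A
  have hwu' : Commute w u := by simpa [← hw, hwu] using hvw.map A
  refine ⟨hwu, huv, hvw, hwu', ?_, ?_, hBw⟩
  · rw [hBu, htw, hvw.inv_right.eq]
  · rw [h4, hAt, mul_inv_rev, inv_inv, hwu'.symm.inv_right.eq]

theorem second_involution (h : TetTriple a b d) :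
    a * (a * b * a⁻¹) * a⁻¹ = b * (a * b * a⁻¹) ∧ Commute b (a * b * a⁻¹) := by
  have h1 : b * (a * b * a⁻¹) = a⁻¹ * (b * a) := by
    simp only [mul_assoc, h.bab_mul, h.a_inv_mul_a_inv]
  have h2 : a * b * a⁻¹ * b = a⁻¹ * (b * a) := by
    have h3 := h.b_a_inv_b_mul 1
    rw [mul_one, mul_one] at h3
    simp only [mul_assoc, h3, h.a_mul_a_mul]
  exact ⟨by rw [h1]; simp only [mul_assoc, h.a_mul_a_mul, h.a_inv_mul_a_inv], h1.trans h2.symm⟩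

/-- The translation with given coordinates. -/
def latticeHom {u v w : G} (huv : Commute u v) (hvw : Commute v w) (hwu : Commute w u) :
    Multiplicative (Fin 3 → ℤ) →* G :=
  MonoidHom.mk' (fun n => u ^ n.toAdd 0 * v ^ n.toAdd 1 * w ^ n.toAdd 2) fun m n => by
    have h2 := fun p q : ℤ => (hvw.symm.zpow_zpow p q).left_comm
    have h3 := fun p q : ℤ => (hwu.zpow_zpow p q).left_comm
    have h4 := fun p q : ℤ => (huv.symm.zpow_zpow p q).left_comm
    simp only [toAdd_mul, Pi.add_apply, zpow_add, mul_assoc, h2, h3, h4]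

theorem latticeHom_apply {u v w : G} (huv : Commute u v) (hvw : Commute v w)
    (hwu : Commute w u) (n : Multiplicative (Fin 3 → ℤ)) :
    latticeHom huv hvw hwu n = u ^ n.toAdd 0 * v ^ n.toAdd 1 * w ^ n.toAdd 2 := rfl

/-- The elements that are a translation times an element of the point group. -/
def normalForms {u v w : G} (huv : Commute u v) (hvw : Commute v w) (hwu : Commute w u)
    (a b : G) : Set G :=
  {g | ∃ (n : Multiplicative (Fin 3 → ℤ)) (i j k : ℕ),
    g = latticeHom huv hvw hwu n * (b ^ i * (a * b * a⁻¹) ^ j * a ^ k)}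

theorem a_mul_mem_normalForms (h : TetTriple a b d) {u v w : G} (huv : Commute u v)
    (hvw : Commute v w) (hwu : Commute w u) (hv : v = a * u * a⁻¹) (hw : w = a * v * a⁻¹)
    (hu : a * w * a⁻¹ = u) {g : G} (hg : g ∈ normalForms huv hvw hwu a b) :
    a * g ∈ normalForms huv hvw hwu a b := by
  obtain ⟨n, i, j, k, rfl⟩ := hg
  obtain ⟨h1, h2⟩ := h.second_involution
  have hn : a * latticeHom huv hvw hwu n * a⁻¹ =
      latticeHom huv hvw hwu (.ofAdd ![n.toAdd 2, n.toAdd 0, n.toAdd 1]) := by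
    have e (x y z : ℤ) : a * (u ^ x * v ^ y * w ^ z) * a⁻¹ = u ^ z * v ^ x * w ^ y := by
      have e1 : a * (u ^ x * v ^ y * w ^ z) * a⁻¹ =
          (a * u * a⁻¹) ^ x * (a * v * a⁻¹) ^ y * (a * w * a⁻¹) ^ z := by
        simp only [conj_zpow]; group
      rw [e1, ← hv, ← hw, hu, mul_assoc, (hwu.zpow_zpow y z).eq, ← mul_assoc,
        (huv.symm.zpow_zpow x z).eq]
    simp [latticeHom_apply, e]
  have hH : a * (b ^ i * (a * b * a⁻¹) ^ j * a ^ k) * a⁻¹ * a =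
      b ^ j * (a * b * a⁻¹) ^ (i + j) * a ^ (k + 1) := by
    have e1 : a * (b ^ i * (a * b * a⁻¹) ^ j * a ^ k) * a⁻¹ * a =
        (a * b * a⁻¹) ^ i * (a * (a * b * a⁻¹) * a⁻¹) ^ j * a ^ (k + 1) := by
      rw [conj_pow (i := i), conj_pow (i := j) (b := a * b * a⁻¹), pow_succ' a]; group
    rw [e1, h1, h2.mul_pow, ← mul_assoc, ← (h2.pow_pow j i).eq, mul_assoc (b ^ j), ← pow_add]
  rw [show a * (latticeHom huv hvw hwu n * (b ^ i * (a * b * a⁻¹) ^ j * a ^ k)) =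
      a * latticeHom huv hvw hwu n * a⁻¹ *
        (a * (b ^ i * (a * b * a⁻¹) ^ j * a ^ k) * a⁻¹ * a) by group, hn, hH]
  exact ⟨_, _, _, _, rfl⟩

theorem b_mul_mem_normalForms (h : TetTriple a b d) {u v w : G} (huv : Commute u v)
    (hvw : Commute v w) (hwu : Commute w u) (hu : b * u * b = w⁻¹ * v)
    (hv : b * v * b = w⁻¹ * u) (hw : b * w * b = w⁻¹) {g : G}
    (hg : g ∈ normalForms huv hvw hwu a b) : b * g ∈ normalForms huv hvw hwu a b := by
  obtain ⟨n, i, j, k, rfl⟩ := hg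
  have hn : b * latticeHom huv hvw hwu n * b⁻¹ =
      latticeHom huv hvw hwu
        (.ofAdd ![n.toAdd 1, n.toAdd 0, -n.toAdd 0 - n.toAdd 1 - n.toAdd 2]) := by
    have e (x y z : ℤ) : b * (u ^ x * v ^ y * w ^ z) * b⁻¹ =
        u ^ y * v ^ x * w ^ (-x - y - z) := by
      have e1 : b * (u ^ x * v ^ y * w ^ z) * b⁻¹ =
          (b * u * b⁻¹) ^ x * (b * v * b⁻¹) ^ y * (b * w * b⁻¹) ^ z := by
        simp only [conj_zpow]; group
      rw [e1, h.b_inv, hu, hv, hw, hvw.symm.inv_left.mul_zpow, hwu.inv_left.mul_zpow]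
      have c1 := fun p q : ℤ => (hvw.symm.zpow_zpow p q).left_comm
      have c2 := fun p q : ℤ => (hwu.zpow_zpow p q).left_comm
      have c3 := fun p q : ℤ => (huv.symm.zpow_zpow p q).left_comm
      simp only [inv_zpow', sub_eq_add_neg, zpow_add, mul_assoc, c1, c2, c3]
    simp [latticeHom_apply, e]
  rw [show b * (latticeHom huv hvw hwu n * (b ^ i * (a * b * a⁻¹) ^ j * a ^ k)) =
      b * latticeHom huv hvw hwu n * b⁻¹ *
        (b ^ (i + 1) * (a * b * a⁻¹) ^ j * a ^ k) by rw [pow_succ']; group, hn]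
  exact ⟨_, _, _, _, rfl⟩

theorem lattice_mul_mem_normalForms {u v w : G} {huv : Commute u v} {hvw : Commute v w}
    {hwu : Commute w u} (m : Multiplicative (Fin 3 → ℤ)) {g : G}
    (hg : g ∈ normalForms huv hvw hwu a b) :
    latticeHom huv hvw hwu m * g ∈ normalForms huv hvw hwu a b := by
  obtain ⟨n, i, j, k, rfl⟩ := hg
  exact ⟨m * n, i, j, k, by rw [_root_.map_mul, mul_assoc (latticeHom _ _ _ m)]⟩

/-- Every element of the group generated by `a`, `b` and `d` has a normal form. -/
theorem mem_normalForms (h : TetTriple a b d) {u v w : G} (hu : u = transl a b d)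
    (hv : v = a * u * a⁻¹) (hw : w = a * v * a⁻¹) (huv : Commute u v) (hvw : Commute v w)
    (hwu : Commute w u) {g : G} (hg : g ∈ Subgroup.closure {a, b, d}) :
    g ∈ normalForms huv hvw hwu a b := by
  obtain ⟨ha', -, -, -, hb1, hb2, hb3⟩ := h.lattice u v w hu hv hw
  have hA {x : G} := h.a_mul_mem_normalForms huv hvw hwu hv hw ha' (g := x)
  have hB {x : G} := h.b_mul_mem_normalForms huv hvw hwu hb1 hb2 hb3 (g := x)
  have hU {x : G} (hx : x ∈ normalForms huv hvw hwu a b) :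
      u * x ∈ normalForms huv hvw hwu a b := by
    simpa [latticeHom_apply] using lattice_mul_mem_normalForms (.ofAdd ![1, 0, 0]) hx
  have hD {x : G} (hx : x ∈ normalForms huv hvw hwu a b) :
      d * x ∈ normalForms huv hvw hwu a b := by
    have := hB (hU (hB (hA (hA (hB hx)))))
    rwa [h.a_mul_a_mul, show b * (u * (b * (a⁻¹ * (b * x)))) = d * x by
      conv_rhs => rw [h.d_eq, ← hu]
      simp only [mul_assoc]] at this
  have key : ∀ x ∈ normalForms huv hvw hwu a b,
      g * x ∈ normalForms huv hvw hwu a b ∧ g⁻¹ * x ∈ normalForms huv hvw hwu a b := by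
    induction hg using Subgroup.closure_induction with
    | mem y hy =>
      intro x hx
      rcases hy with rfl | rfl | rfl
      · exact ⟨hA hx, by simpa only [h.a_mul_a_mul] using hA (hA hx)⟩
      · exact ⟨hB hx, by simpa only [h.b_inv] using hB hx⟩
      · refine ⟨hD hx, ?_⟩
        rw [show y⁻¹ * x = y * (y * x) by
          rw [inv_mul_eq_iff_eq_mul, ← mul_assoc, ← mul_assoc, ← pow_two, ← pow_succ, h.d_pow,
            one_mul]]
        exact hD (hD hx)
    | one => simp
    | mul y z _ _ hy hz =>
      intro x hx
      rw [mul_assoc, mul_inv_rev, mul_assoc]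
      exact ⟨(hy _ (hz x hx).1).1, (hz _ (hy x hx).2).2⟩
    | inv y _ hy => exact fun x hx => ⟨(hy x hx).2, by simpa using (hy x hx).1⟩
  simpa using (key 1 ⟨1, 0, 0, 0, by simp⟩).1

end Relations

end TetTriple

namespace TetGroup

/-- The image of the first generator in `A₄`. -/
def altA : alternatingGroup (Fin 4) :=
  ⟨c[0, 1, 2], Equiv.Perm.mem_alternatingGroup.2 (by decide)⟩

/-- The image of the second generator in `A₄`. -/
def altB : alternatingGroup (Fin 4) :=
  ⟨c[0, 3] * c[1, 2], Equiv.Perm.mem_alternatingGroup.2 (by decide)⟩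

/-- The image of the fourth generator in `A₄`. -/
def altD : alternatingGroup (Fin 4) :=
  ⟨c[0, 3, 2], Equiv.Perm.mem_alternatingGroup.2 (by decide)⟩

theorem tetTriple_alt : TetTriple altA altB altD := by
  constructor <;> decide

theorem alt_normalForm_surjective (x : alternatingGroup (Fin 4)) :
    ∃ (i j : Fin 2) (k : Fin 3),
      altB ^ (i : ℕ) * (altA * altB * altA⁻¹) ^ (j : ℕ) * altA ^ (k : ℕ) = x := by
  revert x; decide

theorem alt_normalForm_injective (i j : Fin 2) (k : Fin 3)
    (h : altB ^ (i : ℕ) * (altA * altB * altA⁻¹) ^ (j : ℕ) * altA ^ (k : ℕ) = 1) :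
    i = 0 ∧ j = 0 ∧ k = 0 := by
  revert i j k; decide

theorem transl_alt : TetTriple.transl altA altB altD = 1 := by decide

/-- The coordinate rotation induced by the first generator. -/
def rotA : Equiv.Perm (Fin 3 → ℤ) where
  toFun p := ![p 2, p 0, p 1]
  invFun p := ![p 1, p 2, p 0]
  left_inv p := by ext i; fin_cases i <;> rfl
  right_inv p := by ext i; fin_cases i <;> rfl

/-- The half turn induced by the second generator. -/
def rotB : Equiv.Perm (Fin 3 → ℤ) where
  toFun p := ![p 1, p 0, -p 0 - p 1 - p 2]
  invFun p := ![p 1, p 0, -p 0 - p 1 - p 2]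
  left_inv p := by ext i; fin_cases i <;> simp; ring
  right_inv p := by ext i; fin_cases i <;> simp; ring

/-- The affine rotation induced by the fourth generator. -/
def rotD : Equiv.Perm (Fin 3 → ℤ) where
  toFun p := ![p 0, 1 - p 0 - p 1 - p 2, p 1 - 1]
  invFun p := ![p 0, p 2 + 1, - p 0 - p 1 - p 2]
  left_inv p := by ext i; fin_cases i <;> simp; ring
  right_inv p := by ext i; fin_cases i <;> simp; ring

theorem tetTriple_rot : TetTriple rotA rotB rotD := by
  constructor <;> ext p i <;> fin_cases i <;>
    simp [pow_succ, rotA, rotB, rotD] <;> ring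

theorem transl_rot : TetTriple.transl rotA rotB rotD = Equiv.addLeft ![1, 0, 0] := by
  ext p i; fin_cases i <;> simp [TetTriple.transl, rotA, rotB, rotD] <;> ring

theorem rotA_conj_addLeft (x y z : ℤ) :
    rotA * Equiv.addLeft ![x, y, z] * rotA⁻¹ = Equiv.addLeft ![z, x, y] := by
  rw [mul_inv_eq_iff_eq_mul]
  ext p i; fin_cases i <;> simp [rotA] <;> rfl

/-- The translation action of `ℤ³` on itself. -/
def translationHom : Multiplicative (Fin 3 → ℤ) →* Equiv.Perm (Fin 3 → ℤ) :=
  MonoidHom.mk' (fun n => Equiv.addLeft n.toAdd) fun m n => by ext p i; simp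

/-- The group `T(3,3;2,2;3,3)`. -/
abbrev Tet : Type := PresentedGroup (tetRels 3 3 3)

theorem tetTriple_of :
    TetTriple (PresentedGroup.of 0 : Tet) (PresentedGroup.of 1) (PresentedGroup.of 3) := by
  have rel {r : FreeGroup (Fin 4)} (hr : r ∈ tetRels 3 3 3) :
      PresentedGroup.mk (tetRels 3 3 3) r = 1 := PresentedGroup.one_of_mem hr
  have hc : (PresentedGroup.of 2 : Tet) ^ 2 = 1 := rel (by simp [tetRels])
  have habcd : (PresentedGroup.of 0 * PresentedGroup.of 1 * PresentedGroup.of 2 *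
      PresentedGroup.of 3 : Tet) = 1 := rel (by simp [tetRels])
  refine ⟨rel (by simp [tetRels]), rel (by simp [tetRels]), rel (by simp [tetRels]),
    rel (by simp [tetRels]), rel (by simp [tetRels]), ?_⟩
  rw [mul_assoc, mul_assoc, mul_eq_one_iff_eq_inv] at habcd
  have hdab : (PresentedGroup.of 3 * PresentedGroup.of 0 * PresentedGroup.of 1 : Tet) =
      (PresentedGroup.of 2)⁻¹ := by
    rw [habcd]; group
  rw [hdab, inv_pow, hc, inv_one]

end TetGroup

/-- A triple satisfying the relations defines a homomorphism from `T(3,3;2,2;3,3)`. -/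
def TetTriple.hom {G : Type*} [Group G] {a b d : G} (h : TetTriple a b d) :
    TetGroup.Tet →* G :=
  PresentedGroup.toGroup (f := ![a, b, (d * a * b)⁻¹, d]) <| by
    intro r hr
    simp only [tetRels, Set.mem_insert_iff, Set.mem_singleton_iff] at hr
    rcases hr with rfl | rfl | rfl | rfl | rfl | rfl | rfl
    · simpa using h.a_pow
    · simpa using h.b_pow
    · have := h.dab_pow
      rw [← inv_inj, ← inv_pow, inv_one] at this
      simpa using this
    · simpa using h.d_pow
    · simp
    · simpa using h.ab_pow
    · simpa using h.bd_pow

namespace TetGroup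

section Hom

variable {G : Type*} [Group G] {a b d : G} (h : TetTriple a b d)

theorem hom_of_zero : h.hom (PresentedGroup.of 0) = a := by simp [TetTriple.hom]

theorem hom_of_one : h.hom (PresentedGroup.of 1) = b := by simp [TetTriple.hom]

theorem hom_of_three : h.hom (PresentedGroup.of 3) = d := by simp [TetTriple.hom]

end Hom

theorem closure_eq_top :
    Subgroup.closure {(PresentedGroup.of 0 : Tet), PresentedGroup.of 1, PresentedGroup.of 3} =
      ⊤ := by
  rw [eq_top_iff, ← PresentedGroup.closure_range_of, Subgroup.closure_le]
  have h0 : (PresentedGroup.of 0 : Tet) ∈ Subgroup.closure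
    {(PresentedGroup.of 0 : Tet), PresentedGroup.of 1, PresentedGroup.of 3} :=
    Subgroup.subset_closure (by simp)
  have h1 : (PresentedGroup.of 1 : Tet) ∈ Subgroup.closure
    {(PresentedGroup.of 0 : Tet), PresentedGroup.of 1, PresentedGroup.of 3} :=
    Subgroup.subset_closure (by simp)
  have h3 : (PresentedGroup.of 3 : Tet) ∈ Subgroup.closure
    {(PresentedGroup.of 0 : Tet), PresentedGroup.of 1, PresentedGroup.of 3} :=
    Subgroup.subset_closure (by simp)
  have habcd : (PresentedGroup.of 0 * PresentedGroup.of 1 * PresentedGroup.of 2 *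
      PresentedGroup.of 3 : Tet) = 1 :=
    PresentedGroup.one_of_mem (rels := tetRels 3 3 3) (by simp [tetRels])
  have h2 : (PresentedGroup.of 2 : Tet) = (PresentedGroup.of 0 * PresentedGroup.of 1)⁻¹ *
      (PresentedGroup.of 3)⁻¹ := by
    rw [eq_inv_mul_iff_mul_eq, ← mul_eq_one_iff_eq_inv, habcd]
  rintro _ ⟨i, rfl⟩
  fin_cases i
  · exact h0
  · exact h1
  · exact h2 ▸ mul_mem (inv_mem (mul_mem h0 h1)) (inv_mem h3)
  · exact h3

theorem alt_hom_surjective : Function.Surjective tetTriple_alt.hom := fun x => by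
  obtain ⟨i, j, k, rfl⟩ := alt_normalForm_surjective x
  refine ⟨PresentedGroup.of 1 ^ (i : ℕ) * (PresentedGroup.of 0 * PresentedGroup.of 1 *
    (PresentedGroup.of 0)⁻¹) ^ (j : ℕ) * PresentedGroup.of 0 ^ (k : ℕ), ?_⟩
  simp [hom_of_zero, hom_of_one]

/-- The kernel of the map onto `A₄` is free abelian of rank three. -/
theorem nonempty_ker_mulEquiv :
    Nonempty (Multiplicative (Fin 3 → ℤ) ≃* tetTriple_alt.hom.ker) := by
  obtain ⟨a, ha⟩ : ∃ a : Tet, a = PresentedGroup.of 0 := ⟨_, rfl⟩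
  obtain ⟨b, hb⟩ : ∃ b : Tet, b = PresentedGroup.of 1 := ⟨_, rfl⟩
  obtain ⟨d, hd⟩ : ∃ d : Tet, d = PresentedGroup.of 3 := ⟨_, rfl⟩
  have h := tetTriple_of
  have htop := closure_eq_top
  have hom_a {G : Type} [Group G] {a' b' d' : G} (h : TetTriple a' b' d') : h.hom a = a' :=
    ha ▸ hom_of_zero h
  have hom_b {G : Type} [Group G] {a' b' d' : G} (h : TetTriple a' b' d') : h.hom b = b' :=
    hb ▸ hom_of_one h
  have hom_d {G : Type} [Group G] {a' b' d' : G} (h : TetTriple a' b' d') : h.hom d = d' :=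
    hd ▸ hom_of_three h
  rw [← ha, ← hb, ← hd] at h htop
  obtain ⟨u, hu⟩ : ∃ u, u = TetTriple.transl a b d := ⟨_, rfl⟩
  obtain ⟨v, hv⟩ : ∃ v, v = a * u * a⁻¹ := ⟨_, rfl⟩
  obtain ⟨w, hw⟩ : ∃ w, w = a * v * a⁻¹ := ⟨_, rfl⟩
  obtain ⟨-, huv, hvw, hwu, -⟩ := h.lattice u v w hu hv hw
  have hom_u {G : Type} [Group G] {a' b' d' : G} (h : TetTriple a' b' d') :
      h.hom u = TetTriple.transl a' b' d' := by
    simp [hu, TetTriple.transl, hom_a, hom_b, hom_d]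
  set τ := TetTriple.latticeHom huv hvw hwu with hτ
  have hτ_ker (n) : tetTriple_alt.hom (τ n) = 1 := by
    simp [hτ, TetTriple.latticeHom_apply, hw, hv, hom_u, transl_alt]
  have hτ_rot (n) : tetTriple_rot.hom (τ n) = translationHom n := by
    have hu' : tetTriple_rot.hom u = translationHom (.ofAdd ![1, 0, 0]) :=
      (hom_u _).trans transl_rot
    have hv' : tetTriple_rot.hom v = translationHom (.ofAdd ![0, 1, 0]) := by
      rw [hv, _root_.map_mul, _root_.map_mul, _root_.map_inv, hom_a, hu']
      exact rotA_conj_addLeft 1 0 0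
    have hw' : tetTriple_rot.hom w = translationHom (.ofAdd ![0, 0, 1]) := by
      rw [hw, _root_.map_mul, _root_.map_mul, _root_.map_inv, hom_a, hv']
      exact rotA_conj_addLeft 0 1 0
    rw [hτ, TetTriple.latticeHom_apply, _root_.map_mul, _root_.map_mul, map_zpow, map_zpow,
      map_zpow, hu', hv', hw', ← map_zpow translationHom, ← map_zpow translationHom,
      ← map_zpow translationHom, ← _root_.map_mul, ← _root_.map_mul]
    congr 1
    apply Multiplicative.toAdd.injective
    ext i
    fin_cases i <;> simp
  refine ⟨MulEquiv.ofBijective (τ.codRestrict tetTriple_alt.hom.ker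
    fun n => MonoidHom.mem_ker.2 (hτ_ker n)) ⟨?_, ?_⟩⟩
  · rw [injective_iff_map_eq_one]
    intro n hn
    have h1 : τ n = 1 := congrArg Subtype.val hn
    have h2 := hτ_rot n
    rw [h1, _root_.map_one] at h2
    have h3 := congrArg (fun e : Equiv.Perm (Fin 3 → ℤ) => e 0) h2
    exact Multiplicative.toAdd.injective (by simpa [translationHom, eq_comm] using h3)
  · rintro ⟨g, hg⟩
    obtain ⟨n, i, j, k, rfl⟩ := h.mem_normalForms hu hv hw huv hvw hwu (htop ▸ Subgroup.mem_top g)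
    rw [MonoidHom.mem_ker, _root_.map_mul, ← hτ, hτ_ker, one_mul] at hg
    have hb1 : (a * b * a⁻¹) ^ 2 = 1 := by rw [conj_pow, h.b_pow]; group
    have hH : b ^ i * (a * b * a⁻¹) ^ j * a ^ k = 1 := by
      rw [pow_eq_pow_mod i h.b_pow, pow_eq_pow_mod j hb1, pow_eq_pow_mod k h.a_pow] at hg ⊢
      have := alt_normalForm_injective ⟨i % 2, Nat.mod_lt _ (by decide)⟩
        ⟨j % 2, Nat.mod_lt _ (by decide)⟩ ⟨k % 3, Nat.mod_lt _ (by decide)⟩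
        (by simpa [hom_a, hom_b] using hg)
      simp only [Fin.ext_iff, Fin.val_zero] at this
      simp [this]
    exact ⟨n, Subtype.ext ((congrArg (τ n * ·) hH).trans (mul_one _)).symm⟩

end TetGroup

/-- The tetrahedral group `T(3,3;2,2;3,3)` admits a surjection onto the alternating
group `A4` whose kernel has abelianization isomorphic to `ℤ³`. -/
theorem tet_3_3_3_surjects_onto_A4_with_Z3_kernel_abelianization :
    ∃ φ : PresentedGroup (tetRels 3 3 3) →* alternatingGroup (Fin 4),
      Function.Surjective φ ∧
      Nonempty (Abelianization φ.ker ≃* Multiplicative (Fin 3 → ℤ)) := by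
  obtain ⟨e⟩ := TetGroup.nonempty_ker_mulEquiv
  exact ⟨TetGroup.tetTriple_alt.hom, TetGroup.alt_hom_surjective,
    ⟨e.symm.abelianizationCongr.trans Abelianization.equivOfComm.symm⟩⟩
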